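/- Let f : (R,m,k) → (S,n,ℓ) be a local homomorphism of commutative Noetherian local rings of prime characteristic p, M ≠ 0 a finitely generated R-module of depth v, and N a finitely generated S-module (viewed as an R-module via f). Suppose e ≥ crs_p(M) and Ext_R^i(N, eM) = 0 for all i = t, …, t+v for some t ≥ 1, where eM is M with R-action through the e-th Frobenius iterate. Then the flat dimension of N over R is at most t−1, and hence pd_R(N) ≤ t−1+dim R. -/

import Mathlib

open CategoryTheory IsLocalRing

/-- `M` viewed as an `R`-module through the `e`-th iterate of Frobenius. -/
def FrobTwist (R : Type) [CommRing R] (p : ℕ) [ExpChar R p] (e : ℕ)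
    (M : Type) [AddCommGroup M] [Module R M] : Type := M

instance (R : Type) [CommRing R] (p : ℕ) [ExpChar R p] (e : ℕ)
    (M : Type) [AddCommGroup M] [Module R M] : AddCommGroup (FrobTwist R p e M) :=
  inferInstanceAs (AddCommGroup M)

instance (R : Type) [CommRing R] (p : ℕ) [ExpChar R p] (e : ℕ)
    (M : Type) [AddCommGroup M] [Module R M] : Module R (FrobTwist R p e M) :=
  Module.compHom M (iterateFrobenius R p e)

/-- Restriction of scalars along `f : R →+* S`. -/
def Restrict {R S : Type} [CommRing R] [CommRing S] (f : R →+* S)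
    (B : Type) [AddCommGroup B] [Module S B] : Type := B

instance {R S : Type} [CommRing R] [CommRing S] (f : R →+* S)
    (B : Type) [AddCommGroup B] [Module S B] : AddCommGroup (Restrict f B) :=
  inferInstanceAs (AddCommGroup B)

instance {R S : Type} [CommRing R] [CommRing S] (f : R →+* S)
    (B : Type) [AddCommGroup B] [Module S B] : Module R (Restrict f B) :=
  Module.compHom B f

/-- `Ext^n_R(A, B)`. -/
noncomputable def extGroup (R : Type) [CommRing R] (n : ℕ)
    (A B : Type) [AddCommGroup A] [Module R A] [AddCommGroup B] [Module R B] : ModuleCat R :=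
  ((Ext R (ModuleCat R) n).obj (Opposite.op (ModuleCat.of R A))).obj (ModuleCat.of R B)

/-- `fd_R Y ≤ n`, via vanishing of `Tor_i^R(X, Y)` for all `X` and `i > n`. -/
noncomputable def flatDimLE (R : Type) [CommRing R]
    (Y : Type) [AddCommGroup Y] [Module R Y] (n : ℕ) : Prop :=
  ∀ (X : ModuleCat R) (i : ℕ), n < i →
    Subsingleton (((Tor (ModuleCat R) i).obj X).obj (ModuleCat.of R Y))

/-- `pd_R Y ≤ n`, via vanishing of `Ext^i_R(Y, X)` for all `X` and `i > n`. -/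
noncomputable def projDimLE (R : Type) [CommRing R]
    (Y : Type) [AddCommGroup Y] [Module R Y] (n : ℕ) : Prop :=
  ∀ (X : ModuleCat R) (i : ℕ), n < i →
    Subsingleton (((Ext R (ModuleCat R) i).obj (Opposite.op (ModuleCat.of R Y))).obj X)


theorem oldExt_succ_iff (R : Type) [CommRing R] (n : ℕ) (A B : ModuleCat.{0} R) (P : ProjectiveResolution A) :
    Subsingleton (((Ext R (ModuleCat R) (n+1)).obj (Opposite.op A)).obj B) ↔
    ∀ f : P.complex.X (n+1) ⟶ B, P.complex.d (n+2) (n+1) ≫ f = 0 → ∃ g : P.complex.X n ⟶ B, P.complex.d (n+1) n ≫ g = f := by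
  rw [← ModuleCat.isZero_iff_subsingleton, (P.isoExt (R := R) (n+1) B).isZero_iff,
    ← HomologicalComplex.exactAt_iff_isZero_homology,
    HomologicalComplex.exactAt_iff' _ n (n+1) (n+2) (by simp) (by simp), ShortComplex.moduleCat_exact_iff]
  rfl

theorem oldExt_zero_iff (R : Type) [CommRing R] (A B : ModuleCat.{0} R) (P : ProjectiveResolution A) :
    Subsingleton (((Ext R (ModuleCat R) 0).obj (Opposite.op A)).obj B) ↔
    ∀ f : P.complex.X 0 ⟶ B, P.complex.d 1 0 ≫ f = 0 → f = 0 := by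
  rw [← ModuleCat.isZero_iff_subsingleton, (P.isoExt (R := R) 0 B).isZero_iff,
    ← HomologicalComplex.exactAt_iff_isZero_homology,
    HomologicalComplex.exactAt_iff' _ 0 0 1 (by simp) (by simp), ShortComplex.moduleCat_exact_iff]
  have h0 : (P.complex.linearYonedaObj R B).d 0 0 = 0 := HomologicalComplex.shape _ _ _ (by simp)
  constructor
  · intro h f hf
    obtain ⟨g, hg⟩ := h f hf
    rw [← hg]
    exact congrArg (fun u => u.hom g) h0
  · intro h f hf
    exact ⟨0, by rw [map_zero]; exact (h f hf).symm⟩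

theorem newExt_succ_iff (R : Type) [CommRing R] (n : ℕ) (A B : ModuleCat.{0} R) (P : ProjectiveResolution A) :
    Subsingleton (Abelian.Ext A B (n+1)) ↔
    ∀ f : P.complex.X (n+1) ⟶ B, P.complex.d (n+2) (n+1) ≫ f = 0 → ∃ g : P.complex.X n ⟶ B, P.complex.d (n+1) n ≫ g = f := by
  constructor
  · intro h f hf
    exact (P.extMk_eq_zero_iff f (n+2) rfl hf n rfl).1 (Subsingleton.elim _ _)
  · intro h
    refine subsingleton_of_forall_eq 0 fun x => ?_
    obtain ⟨f, hf, rfl⟩ := P.extMk_surjective x (n+2) rfl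
    exact (P.extMk_eq_zero_iff f (n+2) rfl hf n rfl).2 (h f hf)


theorem oldExt_of_new (R : Type) [CommRing R] (n : ℕ) (A B : ModuleCat.{0} R)
    (h : Subsingleton (Abelian.Ext A B n)) :
    Subsingleton (((Ext R (ModuleCat R) n).obj (Opposite.op A)).obj B) := by
  cases n with
  | succ n =>
    rwa [oldExt_succ_iff R n A B (projectiveResolution A),
      ← newExt_succ_iff R n A B (projectiveResolution A)]
  | zero =>
    rw [oldExt_zero_iff R A B (projectiveResolution A)]
    rw [Abelian.Ext.addEquiv₀.subsingleton_congr] at h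
    intro f hf
    have h2 := (projectiveResolution A).exact₀.g_desc f hf
    have w0 : ((projectiveResolution A).exact₀.desc f hf : A ⟶ B) = 0 := @Subsingleton.elim (A ⟶ B) h _ _
    rw [← h2]
    refine Eq.trans (congrArg (fun u : A ⟶ B => ((projectiveResolution A).π.f 0 ≫ u)) w0) ?_
    exact Limits.comp_zero

theorem newExt_of_old (R : Type) [CommRing R] (n : ℕ) (A B : ModuleCat.{0} R)
    (h : Subsingleton (((Ext R (ModuleCat R) (n+1)).obj (Opposite.op A)).obj B)) :
    Subsingleton (Abelian.Ext A B (n+1)) := by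
  rwa [newExt_succ_iff R n A B (projectiveResolution A),
      ← oldExt_succ_iff R n A B (projectiveResolution A)]

/-- Vanishing of Ext. -/
def VE (R : Type) [CommRing R] (A B : Type) [AddCommGroup A] [Module R A]
    [AddCommGroup B] [Module R B] (n : ℕ) : Prop :=
  Subsingleton (Abelian.Ext (ModuleCat.of R A) (ModuleCat.of R B) n)

section VE
variable {R : Type} [CommRing R] {A B : Type} [AddCommGroup A] [Module R A]
    [AddCommGroup B] [Module R B]
variable {X Y Z : Type} [AddCommGroup X] [Module R X] [AddCommGroup Y] [Module R Y]
    [AddCommGroup Z] [Module R Z]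

theorem exists_shortExact (f : X →ₗ[R] Y) (g : Y →ₗ[R] Z) (hf : Function.Injective f)
    (he : Function.Exact f g) (hg : Function.Surjective g) :
    (ShortComplex.mk (ModuleCat.ofHom f) (ModuleCat.ofHom g)
      (by ext x; exact he.apply_apply_eq_zero x)).ShortExact :=
  ModuleCat.shortComplex_shortExact _ he hf hg

theorem VE.cov1 (f : X →ₗ[R] Y) (g : Y →ₗ[R] Z) (hf : Function.Injective f)
    (he : Function.Exact f g) (hg : Function.Surjective g) {n : ℕ}
    (h3 : VE R A Z n) (h2 : VE R A Y (n+1)) : VE R A X (n+1) := by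
  unfold VE at *
  have hS := exists_shortExact f g hf he hg
  refine subsingleton_of_forall_eq 0 fun x => ?_
  obtain ⟨y, rfl⟩ := Abelian.Ext.covariant_sequence_exact₁ _ hS x (Subsingleton.elim (α := Abelian.Ext (ModuleCat.of R A) (ModuleCat.of R Y) (n+1)) _ _) rfl
  rw [Subsingleton.elim (α := Abelian.Ext (ModuleCat.of R A) (ModuleCat.of R Z) n) y 0, Abelian.Ext.zero_comp]

theorem VE.cov2 (f : X →ₗ[R] Y) (g : Y →ₗ[R] Z) (hf : Function.Injective f)
    (he : Function.Exact f g) (hg : Function.Surjective g) {n : ℕ}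
    (h1 : VE R A X n) (h3 : VE R A Z n) : VE R A Y n := by
  unfold VE at *
  have hS := exists_shortExact f g hf he hg
  refine subsingleton_of_forall_eq 0 fun x => ?_
  obtain ⟨y, rfl⟩ := Abelian.Ext.covariant_sequence_exact₂ _ hS x (Subsingleton.elim (α := Abelian.Ext (ModuleCat.of R A) (ModuleCat.of R Z) n) _ _)
  rw [Subsingleton.elim (α := Abelian.Ext (ModuleCat.of R A) (ModuleCat.of R X) n) y 0, Abelian.Ext.zero_comp]

theorem VE.cov3 (f : X →ₗ[R] Y) (g : Y →ₗ[R] Z) (hf : Function.Injective f)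
    (he : Function.Exact f g) (hg : Function.Surjective g) {n : ℕ}
    (h2 : VE R A Y n) (h1 : VE R A X (n+1)) : VE R A Z n := by
  unfold VE at *
  have hS := exists_shortExact f g hf he hg
  refine subsingleton_of_forall_eq 0 fun x => ?_
  obtain ⟨y, rfl⟩ := Abelian.Ext.covariant_sequence_exact₃ _ hS x rfl (Subsingleton.elim (α := Abelian.Ext (ModuleCat.of R A) (ModuleCat.of R X) (n+1)) _ _)
  rw [Subsingleton.elim (α := Abelian.Ext (ModuleCat.of R A) (ModuleCat.of R Y) n) y 0, Abelian.Ext.zero_comp]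

theorem VE.con1 (f : X →ₗ[R] Y) (g : Y →ₗ[R] Z) (hf : Function.Injective f)
    (he : Function.Exact f g) (hg : Function.Surjective g) {n : ℕ}
    (h2 : VE R Y B n) (h3 : VE R Z B (n+1)) : VE R X B n := by
  unfold VE at *
  have hS := exists_shortExact f g hf he hg
  refine subsingleton_of_forall_eq 0 fun x => ?_
  obtain ⟨y, rfl⟩ := Abelian.Ext.contravariant_sequence_exact₁ hS _ x (add_comm 1 n) (Subsingleton.elim (α := Abelian.Ext (ModuleCat.of R Z) (ModuleCat.of R B) (n+1)) _ _)
  rw [Subsingleton.elim (α := Abelian.Ext (ModuleCat.of R Y) (ModuleCat.of R B) n) y 0, Abelian.Ext.comp_zero]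

theorem VE.con3 (f : X →ₗ[R] Y) (g : Y →ₗ[R] Z) (hf : Function.Injective f)
    (he : Function.Exact f g) (hg : Function.Surjective g) {n : ℕ}
    (h1 : VE R X B n) (h2 : VE R Y B (n+1)) : VE R Z B (n+1) := by
  unfold VE at *
  have hS := exists_shortExact f g hf he hg
  refine subsingleton_of_forall_eq 0 fun x => ?_
  obtain ⟨y, rfl⟩ := Abelian.Ext.contravariant_sequence_exact₃ hS _ x (Subsingleton.elim (α := Abelian.Ext (ModuleCat.of R Y) (ModuleCat.of R B) (n+1)) _ _) (add_comm 1 n)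
  rw [Subsingleton.elim (α := Abelian.Ext (ModuleCat.of R X) (ModuleCat.of R B) n) y 0, Abelian.Ext.comp_zero]

theorem VE.proj [Module.Projective R A] (n : ℕ) : VE R A B (n+1) := by
  unfold VE
  exact Abelian.Ext.subsingleton_of_projective _ _ n

theorem VE.inj (I : ModuleCat.{0} R) [Injective I] (n : ℕ) : VE R A I (n+1) := by
  unfold VE
  exact Abelian.Ext.subsingleton_of_injective _ _ n

theorem VE.sub_right [Subsingleton B] (n : ℕ) : VE R A B n := by
  unfold VE
  refine subsingleton_of_forall_eq 0 fun x => ?_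
  have : 𝟙 (ModuleCat.of R B) = 0 := by ext y; exact Subsingleton.elim _ _
  rw [← x.comp_mk₀_id, this, Abelian.Ext.mk₀_zero, Abelian.Ext.comp_zero]

theorem VE.retract (i : X →ₗ[R] Y) (r : Y →ₗ[R] X) (h : r ∘ₗ i = LinearMap.id) {n : ℕ}
    (hY : VE R A Y n) : VE R A X n := by
  unfold VE at *
  refine subsingleton_of_forall_eq 0 fun x => ?_
  have h1 : ModuleCat.ofHom i ≫ ModuleCat.ofHom r = 𝟙 (ModuleCat.of R X) := by
    rw [← ModuleCat.ofHom_comp, h]; rfl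
  rw [← x.comp_mk₀_id, ← h1, ← Abelian.Ext.mk₀_comp_mk₀, ← Abelian.Ext.comp_assoc_of_second_deg_zero,
    Subsingleton.elim (x.comp (Abelian.Ext.mk₀ (ModuleCat.ofHom i)) (add_zero n)) 0, Abelian.Ext.zero_comp]

/-- Every hom from X extends to Y if Ext^1(Z,B)=0 -/
theorem VE.extend (f : X →ₗ[R] Y) (g : Y →ₗ[R] Z) (hf : Function.Injective f)
    (he : Function.Exact f g) (hg : Function.Surjective g) 
    (h : VE R Z B 1) (φ : X →ₗ[R] B) : ∃ ψ : Y →ₗ[R] B, ψ ∘ₗ f = φ := by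
  unfold VE at *
  have hS := exists_shortExact f g hf he hg
  obtain ⟨y, hy⟩ := Abelian.Ext.contravariant_sequence_exact₁ hS (ModuleCat.of R B) (Abelian.Ext.mk₀ (ModuleCat.ofHom φ)) (add_comm 1 0) (Subsingleton.elim (α := Abelian.Ext (ModuleCat.of R Z) (ModuleCat.of R B) 1) _ _)
  obtain ⟨u, rfl⟩ := Abelian.Ext.homEquiv₀.symm.surjective y
  refine ⟨u.hom, ?_⟩
  simp only [Abelian.Ext.homEquiv₀_symm_apply] at hy
  rw [Abelian.Ext.mk₀_comp_mk₀] at hy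
  have := Abelian.Ext.homEquiv₀.symm.injective hy
  exact congrArg ModuleCat.Hom.hom this

theorem VE.of_extend (f : X →ₗ[R] Y) (g : Y →ₗ[R] Z) (hf : Function.Injective f)
    (he : Function.Exact f g) (hg : Function.Surjective g) [Module.Projective R Y]
    (h : ∀ φ : X →ₗ[R] B, ∃ ψ : Y →ₗ[R] B, ψ ∘ₗ f = φ) : VE R Z B 1 := by
  have hp : VE R Y B 1 := VE.proj 0
  unfold VE at *
  have hS := exists_shortExact f g hf he hg
  refine subsingleton_of_forall_eq 0 fun x => ?_
  obtain ⟨y, rfl⟩ := Abelian.Ext.contravariant_sequence_exact₃ hS _ x (Subsingleton.elim (α := Abelian.Ext (ModuleCat.of R Y) (ModuleCat.of R B) 1) _ _) (add_comm 1 0)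
  obtain ⟨u, rfl⟩ := Abelian.Ext.homEquiv₀.symm.surjective y
  obtain ⟨ψ, hψ⟩ := h u.hom
  have : u = ModuleCat.ofHom f ≫ ModuleCat.ofHom ψ := by
    ext x; exact (LinearMap.congr_fun hψ x).symm
  simp only [Abelian.Ext.homEquiv₀_symm_apply]
  rw [this, ← Abelian.Ext.mk₀_comp_mk₀]
  exact ShortComplex.ShortExact.extClass_comp_assoc hS _

theorem VE.smul_step (s : R) (f : X →ₗ[R] X) (hfs : ∀ x, f x = s • x) (g : X →ₗ[R] Z) (hf : Function.Injective f)
    (he : Function.Exact f g) (hg : Function.Surjective g) 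
    (a : A →ₗ[R] A) (has : ∀ x, a x = s • x) (b : A →ₗ[R] B) (ha : Function.Injective a)
    (hab : Function.Exact a b) (hb : Function.Surjective b) {n : ℕ}
    (h : VE R A Z n) : VE R B X (n+1) := by
  unfold VE at *
  have hS := exists_shortExact f g hf he hg
  have hT := exists_shortExact a b ha hab hb
  have hfs' : ModuleCat.ofHom f = s • 𝟙 (ModuleCat.of R X) := by ext x; exact hfs x
  have has' : ModuleCat.ofHom a = s • 𝟙 (ModuleCat.of R A) := by ext x; exact has x
  have comm : ∀ m (w : Abelian.Ext (ModuleCat.of R A) (ModuleCat.of R X) m), w.comp (Abelian.Ext.mk₀ (ModuleCat.ofHom f)) (add_zero m) = (Abelian.Ext.mk₀ (ModuleCat.ofHom a)).comp w (zero_add m) := by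
    intro m w
    rw [hfs', has', Abelian.Ext.mk₀_smul, Abelian.Ext.mk₀_smul, Abelian.Ext.smul_comp, Abelian.Ext.comp_smul,
      Abelian.Ext.mk₀_id_comp, Abelian.Ext.comp_mk₀_id]
  refine subsingleton_of_forall_eq 0 fun x => ?_
  have key : (Abelian.Ext.mk₀ (ModuleCat.ofHom b)).comp x (zero_add (n+1)) = 0 := by
    set y := (Abelian.Ext.mk₀ (ModuleCat.ofHom b)).comp x (zero_add (n+1)) with hy
    have : y.comp (Abelian.Ext.mk₀ (ModuleCat.ofHom f)) (add_zero (n+1)) = 0 := by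
      rw [comm, hy]
      have := hT.1
      rw [Abelian.Ext.mk₀_comp_mk₀_assoc]
      have h0 : ModuleCat.ofHom a ≫ ModuleCat.ofHom b = 0 := by ext x; exact hab.apply_apply_eq_zero x
      rw [h0, Abelian.Ext.mk₀_zero, Abelian.Ext.zero_comp]
    obtain ⟨z, hz⟩ := Abelian.Ext.covariant_sequence_exact₁ _ hS y this rfl
    rw [← hz, Subsingleton.elim (α := Abelian.Ext (ModuleCat.of R A) (ModuleCat.of R Z) n) z 0, Abelian.Ext.zero_comp]
  obtain ⟨y, rfl⟩ := Abelian.Ext.contravariant_sequence_exact₃ hT _ x key (add_comm 1 n)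
  obtain ⟨w, hw⟩ := Abelian.Ext.covariant_sequence_exact₂ _ hS y (Subsingleton.elim (α := Abelian.Ext (ModuleCat.of R A) (ModuleCat.of R Z) n) _ _)
  have hw' : y = (Abelian.Ext.mk₀ (ModuleCat.ofHom a)).comp w (zero_add n) := by rw [← comm]; exact hw.symm
  rw [hw']
  exact ShortComplex.ShortExact.extClass_comp_assoc hT _

end VE


section cover
variable (R : Type) [CommRing R] (F : Type) [AddCommGroup F] [Module R F]
/-- free cover -/
noncomputable def cov : (F →₀ R) →ₗ[R] F := Finsupp.linearCombination R id
theorem cov_surj : Function.Surjective (cov R F) := Finsupp.linearCombination_id_surjective R F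
/-- kernel of free cover -/
def CovK : Type := LinearMap.ker (cov R F)
noncomputable instance : AddCommGroup (CovK R F) := inferInstanceAs (AddCommGroup (LinearMap.ker (cov R F)))
noncomputable instance : Module R (CovK R F) := inferInstanceAs (Module R (LinearMap.ker (cov R F)))
/-- inclusion of kernel of free cover -/
noncomputable def covi : CovK R F →ₗ[R] (F →₀ R) := (LinearMap.ker (cov R F)).subtype
theorem covi_inj : Function.Injective (covi R F) := Subtype.val_injective
theorem cov_exact : Function.Exact (covi R F) (cov R F) := LinearMap.exact_subtype_ker_map _
end cover

open TensorProduct in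
theorem flat_ker_inj {R : Type} [CommRing R] {Z P F : Type} [AddCommGroup Z] [Module R Z] [AddCommGroup P] [Module R P]
    [AddCommGroup F] [Module R F] (f : Z →ₗ[R] P) (g : P →ₗ[R] F) (hf : Function.Injective f)
    (he : Function.Exact f g) (hg : Function.Surjective g) [Module.Flat R F]
    (X : Type) [AddCommGroup X] [Module R X] : Function.Injective (f.lTensor X) := by
  rw [injective_iff_map_eq_zero]
  intro z hz
  have hq := cov_surj R X
  have hi := cov_exact R X
  have hii := covi_inj R X
  set q := cov R X
  set i := covi R X
  obtain ⟨z', rfl⟩ := LinearMap.rTensor_surjective Z hq z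
  have h1 : q.rTensor P (f.lTensor _ z') = 0 := by
    rw [← hz]; simp only [← LinearMap.comp_apply, LinearMap.rTensor_comp_lTensor, LinearMap.lTensor_comp_rTensor]
  obtain ⟨w, hw⟩ := (rTensor_exact P hi hq _).1 h1
  have h2 : g.lTensor _ w = 0 := by
    apply Module.Flat.rTensor_preserves_injective_linearMap (M := F) i hii
    rw [map_zero]
    have : i.rTensor F (g.lTensor _ w) = g.lTensor _ (i.rTensor P w) := by
      simp only [← LinearMap.comp_apply, LinearMap.rTensor_comp_lTensor, LinearMap.lTensor_comp_rTensor]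
    rw [this, hw]
    exact (lTensor_exact _ he hg).apply_apply_eq_zero z'
  obtain ⟨u, rfl⟩ := (lTensor_exact _ he hg _).1 h2
  have h3 : i.rTensor Z u = z' := by
    apply Module.Flat.lTensor_preserves_injective_linearMap (M := X →₀ R) f hf
    rw [← hw]
    simp only [← LinearMap.comp_apply, LinearMap.rTensor_comp_lTensor, LinearMap.lTensor_comp_rTensor]
  rw [← h3]
  exact (rTensor_exact Z hi hq).apply_apply_eq_zero u

open TensorProduct in
theorem flat_ker {R : Type} [CommRing R] {Z P F : Type} [AddCommGroup Z] [Module R Z] [AddCommGroup P] [Module R P]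
    [AddCommGroup F] [Module R F] (f : Z →ₗ[R] P) (g : P →ₗ[R] F) (hf : Function.Injective f)
    (he : Function.Exact f g) (hg : Function.Surjective g) [Module.Flat R F] [Module.Flat R P] : Module.Flat R Z := by
  rw [Module.Flat.iff_rTensor_preserves_injective_linearMap]
  intro A B _ _ _ _ j hj
  have h1 : Function.Injective (f.lTensor B ∘ₗ j.rTensor Z) := by
    rw [LinearMap.lTensor_comp_rTensor, ← LinearMap.rTensor_comp_lTensor, LinearMap.coe_comp]
    exact (Module.Flat.rTensor_preserves_injective_linearMap j hj).comp (flat_ker_inj f g hf he hg A)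
  rw [LinearMap.coe_comp] at h1
  exact h1.of_comp


theorem cov_flat (R : Type) [CommRing R] (F : Type) [AddCommGroup F] [Module R F] [Module.Flat R F] : Module.Flat R (CovK R F) :=
  flat_ker (covi R F) (cov R F) (covi_inj R F) (cov_exact R F) (cov_surj R F)

open TensorProduct in
theorem change_rings {R : Type} [CommRing R] (A : Type) [CommRing A] [Algebra R A] (X : Type) [AddCommGroup X]
    [Module R X] [Module A X] [IsScalarTower R A X] (i : ℕ) :
    ∀ (F : Type) [AddCommGroup F] [Module R F] [Module.Flat R F],
    VE A (A ⊗[R] F) X (i+1) → VE R F X (i+1) := by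
  induction i with
  | zero =>
    intro F _ _ _ h
    refine VE.of_extend _ _ (covi_inj R F) (cov_exact R F) (cov_surj R F) fun φ => ?_
    obtain ⟨ψ, hψ⟩ := VE.extend ((covi R F).baseChange A) ((cov R F).baseChange A)
      (flat_ker_inj _ _ (covi_inj R F) (cov_exact R F) (cov_surj R F) A)
      (lTensor_exact A (cov_exact R F) (cov_surj R F))
      (LinearMap.lTensor_surjective A (cov_surj R F)) h (LinearMap.liftBaseChange A φ)
    refine ⟨ψ.restrictScalars R ∘ₗ TensorProduct.mk R A _ 1, ?_⟩
    ext x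
    have := LinearMap.congr_fun hψ (1 ⊗ₜ x)
    simpa using this
  | succ i ih =>
    intro F _ _ _ h
    have := cov_flat R F
    have h1 := VE.con1 ((covi R F).baseChange A) ((cov R F).baseChange A)
      (flat_ker_inj _ _ (covi_inj R F) (cov_exact R F) (cov_surj R F) A)
      (lTensor_exact A (cov_exact R F) (cov_surj R F))
      (LinearMap.lTensor_surjective A (cov_surj R F)) (VE.proj _) h
    exact VE.con3 _ _ (covi_inj R F) (cov_exact R F) (cov_surj R F) (ih _ h1) (VE.proj _)

theorem flat_of_chain {R : Type} [CommRing R] {V : Type} [AddCommGroup V] [Module R V] (c : Set (Submodule R V))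
    (hc : DirectedOn (· ≤ ·) c) (hne : c.Nonempty) (hfl : ∀ G ∈ c, Module.Flat R G) : Module.Flat R (sSup c : Submodule R V) := by
  apply Module.Flat.of_forall_isTrivialRelation
  intro l f x hx
  have h1 : ∃ G ∈ c, ∀ i, (x i : V) ∈ G := by
    have h2 : ∀ i, ∃ G ∈ c, (x i : V) ∈ G := fun i => (Submodule.mem_sSup_of_directed hne hc).1 (x i).2
    choose g hg hxg using h2
    have := hc.directed_val
    have : Nonempty c := hne.to_subtype
    obtain ⟨G, hle⟩ := hc.directed_val.finite_le (fun i => (⟨g i, hg i⟩ : c))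
    exact ⟨G, G.2, fun i => hle i (hxg i)⟩
  obtain ⟨G, hG, hxG⟩ := h1
  have := hfl G hG
  have hx' : ∑ i, f i • (⟨x i, hxG i⟩ : G) = 0 := by
    apply Subtype.val_injective
    have := congrArg Subtype.val hx
    simpa using this
  obtain ⟨k, y, a, h3, h4⟩ := Module.Flat.isTrivialRelation_of_sum_smul_eq_zero hx'
  exact ⟨k, y, fun j => ⟨a j, le_sSup hG (a j).2⟩, fun i => by
    have := congrArg Subtype.val (h3 i)
    apply Subtype.val_injective
    simpa using this, h4⟩

theorem zorn_ext {R : Type} [CommRing R] [IsDomain R] {C : Type} [AddCommGroup C] [Module R C]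
    (hdiv : ∀ (G : Type) [AddCommGroup G] [Module R G] [Module.Flat R G] (s : R), s ≠ 0 → ∀ φ : G →ₗ[R] C,
      ∃ ψ : G →ₗ[R] C, ∀ x, ψ (s • x) = φ x)
    (V : Type) [AddCommGroup V] [Module R V] [Module (FractionRing R) V] [IsScalarTower R (FractionRing R) V]
    (Z : Submodule R V) [Module.Flat R Z] (φ : Z →ₗ[R] C) : ∃ ψ : V →ₗ[R] C, ∀ z : Z, ψ z = φ z := by
  let φ0 : V →ₗ.[R] C := ⟨Z, φ⟩
  obtain ⟨g, hg0, hg⟩ := zorn_le_nonempty₀ {g : V →ₗ.[R] C | Module.Flat R g.domain} (by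
    intro c hcs hc y hy
    have hd : DirectedOn (· ≤ ·) c := hc.directedOn
    refine ⟨LinearPMap.sSup c hd, ?_, fun z hz => LinearPMap.le_sSup hd hz⟩
    show Module.Flat R (sSup (LinearPMap.domain '' c) : Submodule R V)
    apply flat_of_chain
    · exact DirectedOn.mono_comp (fun _ _ h => LinearPMap.domain_mono.monotone h) hd
    · exact ⟨_, y, hy, rfl⟩
    · rintro _ ⟨g, hg, rfl⟩; exact hcs hg) φ0 ‹Module.Flat R Z›
  have hflat : Module.Flat R g.domain := hg.1
  have hinj : ∀ s : R, s ≠ 0 → ∀ v w : V, s • v = s • w → v = w := by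
    intro s hs v w h
    have h1 : algebraMap R (FractionRing R) s ≠ 0 := by simpa using hs
    have : ∀ x : V, s • x = algebraMap R (FractionRing R) s • x := fun x => (algebraMap_smul _ _ _).symm
    rw [this, this] at h
    exact smul_right_injective V h1 h
  have key : ∀ s : R, s ≠ 0 → ∀ v : V, s • v ∈ g.domain → v ∈ g.domain := by
    intro s hs
    obtain ⟨ψ, hψ⟩ := hdiv g.domain s hs g.toFun
    let G' : Submodule R V := g.domain.comap (LinearMap.lsmul R V s)
    let u : G' →ₗ[R] g.domain := (LinearMap.lsmul R V s).restrict (p := G') (q := g.domain) (fun x hx => hx)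
    have hu : Function.Bijective u := by
      constructor
      · intro a b hab
        have := congrArg Subtype.val hab
        exact Subtype.val_injective (hinj s hs _ _ this)
      · intro a
        have h1 : algebraMap R (FractionRing R) s ≠ 0 := by simpa using hs
        have h2 : s • ((algebraMap R (FractionRing R) s)⁻¹ • (a : V)) = a := by
          rw [← algebraMap_smul (FractionRing R) s, smul_inv_smul₀ h1]
        refine ⟨⟨(algebraMap R (FractionRing R) s)⁻¹ • (a : V), ?_⟩, ?_⟩
        · show s • _ ∈ g.domain
          rw [h2]; exact a.2
        · exact Subtype.val_injective h2
    have hfl : Module.Flat R G' := Module.Flat.of_linearEquiv (LinearEquiv.ofBijective u hu)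
    let g' : V →ₗ.[R] C := ⟨G', ψ ∘ₗ u⟩
    have hle : g ≤ g' := by
      refine ⟨fun x hx => g.domain.smul_mem s hx, ?_⟩
      intro x y hxy
      have : u y = s • x := Subtype.val_injective (by
        show s • (y : V) = s • (x : V)
        rw [hxy])
      show g.toFun x = ψ (u y)
      rw [this, hψ]
    have := hg.2 (y := g') hfl hle
    intro v hv
    exact this.1 hv
  let W : Submodule (FractionRing R) V :=
    { g.domain with
      smul_mem' := by
        intro c x hx
        obtain ⟨a, b, hb, rfl⟩ := IsFractionRing.div_surjective (A := R) c
        have hb0 : b ≠ 0 := nonZeroDivisors.ne_zero hb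
        apply key b hb0
        have : b • (algebraMap R (FractionRing R) a / algebraMap R (FractionRing R) b) • x = a • x := by
          rw [← algebraMap_smul (FractionRing R) b, smul_smul, mul_div_cancel₀, algebraMap_smul]
          simpa using hb0
        rw [this]
        exact g.domain.smul_mem a hx }
  obtain ⟨π, hπ⟩ := LinearMap.exists_leftInverse_of_injective W.subtype (by simp)
  let π' : V →ₗ[R] g.domain := π.restrictScalars R
  refine ⟨g.toFun ∘ₗ π', fun z => ?_⟩
  have hz : (z : V) ∈ g.domain := hg0.1 z.2
  have h1 : π' z = ⟨z, hz⟩ := LinearMap.congr_fun hπ ⟨z, hz⟩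
  have h2 := hg0.2 (x := z) (y := ⟨z, hz⟩) rfl
  rw [LinearMap.comp_apply, h1]
  exact h2.symm

theorem domain_ext1 {R : Type} [CommRing R] [IsDomain R] {C : Type} [AddCommGroup C] [Module R C]
    (hdiv : ∀ (G : Type) [AddCommGroup G] [Module R G] [Module.Flat R G] (s : R), s ≠ 0 → ∀ φ : G →ₗ[R] C,
      ∃ ψ : G →ₗ[R] C, ∀ x, ψ (s • x) = φ x)
    (F : Type) [AddCommGroup F] [Module R F] [Module.Flat R F] : VE R F C 1 := by
  have hfl := cov_flat R F
  refine VE.of_extend _ _ (covi_inj R F) (cov_exact R F) (cov_surj R F) fun φ => ?_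
  let j : (F →₀ R) →ₗ[R] (F →₀ FractionRing R) := Finsupp.mapRange.linearMap (Algebra.linearMap R (FractionRing R))
  have hj : Function.Injective j := Finsupp.mapRange_injective _ (map_zero _) (IsFractionRing.injective R (FractionRing R))
  let e := LinearEquiv.ofInjective (j ∘ₗ covi R F) (hj.comp (covi_inj R F))
  have : Module.Flat R (LinearMap.range (j ∘ₗ covi R F)) := Module.Flat.of_linearEquiv e.symm
  obtain ⟨ψ, hψ⟩ := zorn_ext hdiv (F →₀ FractionRing R) (LinearMap.range (j ∘ₗ covi R F)) (φ ∘ₗ e.symm.toLinearMap)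
  refine ⟨ψ ∘ₗ j, ?_⟩
  ext x
  have h1 := hψ (e x)
  simp only [LinearMap.comp_apply, LinearEquiv.coe_coe, LinearEquiv.symm_apply_apply] at h1
  exact h1


theorem cosyzygy {R : Type} [CommRing R] (j : ℕ) : ∀ (X : Type) [AddCommGroup X] [Module R X],
    ∃ C : ModuleCat.{0} R, ∀ (A : Type) [AddCommGroup A] [Module R A], VE R A X (j+1) ↔ VE R A C 1 := by
  induction j with
  | zero => intro X _ _; exact ⟨ModuleCat.of R X, fun A _ _ => Iff.rfl⟩
  | succ j ih =>
    intro X _ _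
    let I := Injective.under (ModuleCat.of R X)
    let f : X →ₗ[R] I := (Injective.ι (ModuleCat.of R X)).hom
    have hf : Function.Injective f := (ModuleCat.mono_iff_injective _).1 inferInstance
    obtain ⟨C, hC⟩ := ih (I ⧸ LinearMap.range f)
    refine ⟨C, fun A _ _ => ?_⟩
    rw [← hC]
    have he : Function.Exact f (LinearMap.range f).mkQ := LinearMap.exact_map_mkQ_range f
    have hg := Submodule.mkQ_surjective (LinearMap.range f)
    exact ⟨fun h => VE.cov3 f _ hf he hg (VE.inj I j) h, fun h => VE.cov1 f _ hf he hg h (VE.inj I (j+1))⟩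

/-- dimension-indexed statement -/
def QQ (n : ℕ) : Prop := ∀ (R : Type) [CommRing R] [IsNoetherianRing R], ringKrullDim R + 1 ≤ n →
  ∀ (F : Type) [AddCommGroup F] [Module R F] [Module.Flat R F] (X : Type) [AddCommGroup X] [Module R X] (i : ℕ),
    n ≤ i → VE R F X i

theorem exact_smul {R : Type} [CommRing R] (X : Type) [AddCommGroup X] [Module R X] (s : R) :
    Function.Exact (LinearMap.lsmul R X s) (LinearMap.range (LinearMap.lsmul R X s)).mkQ :=
  LinearMap.exact_map_mkQ_range _

theorem quot_smul {R : Type} [CommRing R] (X : Type) [AddCommGroup X] [Module R X] (s : R) 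
    (y : X ⧸ (LinearMap.range (LinearMap.lsmul R X s))) : s • y = 0 := by
  obtain ⟨x, rfl⟩ := Submodule.mkQ_surjective _ y
  rw [← map_smul]
  exact (exact_smul X s).apply_apply_eq_zero x

theorem killed_VE {R : Type} [CommRing R] (I : Ideal R) (F : Type) [AddCommGroup F] [Module R F] [Module.Flat R F]
    (X : Type) [AddCommGroup X] [Module R X] (hX : ∀ r ∈ I, ∀ x : X, r • x = 0) (j : ℕ)
    (h : ∀ (G : Type) [AddCommGroup G] [Module (R ⧸ I) G] [Module.Flat (R ⧸ I) G] [Module (R ⧸ I) X],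
      VE (R ⧸ I) G X (j+1)) : VE R F X (j+1) := by
  have hX' : Module.IsTorsionBySet R X I := fun x a => hX a a.2 x
  let _ : Module (R ⧸ I) X := hX'.module
  have : IsScalarTower R (R ⧸ I) X := hX'.isScalarTower
  exact change_rings (R ⧸ I) X j F (h _)

theorem domain_step (n : ℕ) (hQ : QQ n) (R : Type) [CommRing R] [IsNoetherianRing R] [IsDomain R]
    (hd : ringKrullDim R + 1 ≤ (n + 1 : ℕ))
    (F : Type) [AddCommGroup F] [Module R F] [Module.Flat R F] (X : Type) [AddCommGroup X] [Module R X] (j : ℕ)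
    (hj : n ≤ j) : VE R F X (j+1) := by
  have hdim : ringKrullDim R ≤ n := by
    have : ringKrullDim R + 1 ≤ (n : WithBot ℕ∞) + 1 := by simpa using hd
    exact (ENat.WithBot.add_le_add_one_right_iff).1 this
  have hs : ∀ s : R, s ≠ 0 → ringKrullDim (R ⧸ Ideal.span {s}) + 1 ≤ n := fun s hs =>
    (ringKrullDim_quotient_succ_le_of_nonZeroDivisor (mem_nonZeroDivisors_of_ne_zero hs)).trans hdim
  have h1 : ∀ (G : Type) [AddCommGroup G] [Module R G] [Module.Flat R G] (X : Type) [AddCommGroup X] [Module R X] (i : ℕ),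
      n ≤ i → ∀ s : R, s ≠ 0 → VE R G (X ⧸ (LinearMap.range (LinearMap.lsmul R X s))) i := by
    intro G _ _ _ X _ _ i hi s hs0
    have hk : ∀ r ∈ Ideal.span {s}, ∀ x : X ⧸ (LinearMap.range (LinearMap.lsmul R X s)), r • x = 0 := by
      intro r hr x
      obtain ⟨c, rfl⟩ := Ideal.mem_span_singleton'.1 hr
      rw [mul_smul, quot_smul, smul_zero]
    cases i with
    | zero =>
      have hn : n = 0 := by omega
      subst hn
      have h2 := hs s hs0
      have : Subsingleton (R ⧸ Ideal.span {s}) := by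
        by_contra hc
        rw [not_subsingleton_iff_nontrivial] at hc
        have h3 := ringKrullDim_nonneg_of_nontrivial (R := R ⧸ Ideal.span {s})
        have h4 : (0 : WithBot ℕ∞) + 1 ≤ (0 : ℕ) := le_trans (by gcongr) h2
        exact absurd h4 (by decide)
      have h5 : (1 : R) ∈ Ideal.span {s} := by
        rw [Ideal.Quotient.subsingleton_iff] at this
        rw [this]; trivial
      have : Subsingleton (X ⧸ (LinearMap.range (LinearMap.lsmul R X s))) :=
        subsingleton_of_forall_eq 0 fun x => by rw [← one_smul R x]; exact hk 1 h5 x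
      exact VE.sub_right 0
    | succ i =>
      refine killed_VE (Ideal.span {s}) G _ hk i ?_
      intro G' _ _ _ _
      exact hQ (R ⧸ Ideal.span {s}) (hs s hs0) G' _ (i+1) hi
  have h2 : ∀ (X : Type) [AddCommGroup X] [Module R X], (∀ s : R, s ≠ 0 → Function.Injective (LinearMap.lsmul R X s)) →
      ∀ j, n ≤ j → VE R F X (j+1) := by
    intro X _ _ htf j hj
    obtain ⟨C, hC⟩ := cosyzygy (R := R) j X
    rw [hC]
    apply domain_ext1
    intro G _ _ _ s hs0 φ
    have hG : Function.Injective (LinearMap.lsmul R G s) :=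
      Module.Flat.isSMulRegular_of_nonZeroDivisors (mem_nonZeroDivisors_of_ne_zero hs0)
    have h3 : VE R (G ⧸ (LinearMap.range (LinearMap.lsmul R G s))) X (j+1) :=
      VE.smul_step s (LinearMap.lsmul R X s) (fun _ => rfl) _ (htf s hs0) (exact_smul X s) (Submodule.mkQ_surjective _)
        (LinearMap.lsmul R G s) (fun _ => rfl) _ hG (exact_smul G s) (Submodule.mkQ_surjective _) (h1 G X j hj s hs0)
    rw [hC] at h3
    obtain ⟨ψ, hψ⟩ := VE.extend _ _ hG (exact_smul G s) (Submodule.mkQ_surjective _) h3 φ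
    exact ⟨ψ, fun x => LinearMap.congr_fun hψ x⟩
  have hfree : ∀ s : R, s ≠ 0 → Function.Injective (LinearMap.lsmul R (X →₀ R) s) := by
    intro s hs0
    exact smul_right_injective (X →₀ R) hs0
  refine VE.cov3 _ _ (covi_inj R X) (cov_exact R X) (cov_surj R X) (h2 _ hfree j hj) (h2 (CovK R X) ?_ (j+1) (by omega))
  intro s hs0 a b hab
  apply covi_inj R X
  apply hfree s hs0
  have := congrArg (covi R X) hab
  simpa using this

theorem QQ_all (n : ℕ) : QQ n := by
  induction n with
  | zero =>
    intro R _ _ hd F _ _ _ X _ _ i _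
    have : Subsingleton R := by
      by_contra hc
      rw [not_subsingleton_iff_nontrivial] at hc
      have h3 := ringKrullDim_nonneg_of_nontrivial (R := R)
      have h4 : (0 : WithBot ℕ∞) + 1 ≤ (0 : ℕ) := le_trans (by gcongr) hd
      exact absurd h4 (by decide)
    have : Subsingleton X := Module.subsingleton R X
    exact VE.sub_right i
  | succ n ih =>
    intro R _ _ hd F _ _ _ X _ _ i hi
    obtain ⟨j, rfl⟩ : ∃ j, i = j + 1 := ⟨i - 1, by omega⟩
    have hj : n ≤ j := by omega
    suffices H : ∀ I : Ideal R, ∀ (X : Type) [AddCommGroup X] [Module R X], (∀ r ∈ I, ∀ x : X, r • x = 0) → VE R F X (j+1) by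
      exact H ⊥ X (by simp)
    intro I
    induction I using IsNoetherian.induction with
    | hgt I IH =>
    intro X _ _ hX
    by_cases htop : I = ⊤
    · have : Subsingleton X := subsingleton_of_forall_eq 0 fun x => by
        rw [← one_smul R x]; exact hX 1 (by rw [htop]; trivial) x
      exact VE.sub_right _
    by_cases hp : Ideal.IsPrime (I : Ideal R)
    · refine killed_VE I F X hX j ?_
      intro G _ _ _ _
      refine domain_step n ih (R ⧸ I) (le_trans ?_ hd) G X j hj
      gcongr
      exact ringKrullDim_quotient_le I
    · rw [Ideal.isPrime_iff] at hp
      push Not at hp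
      obtain ⟨a, b, hab, ha, hb⟩ := hp htop
      have hlt : ∀ c ∉ I, I < I ⊔ Ideal.span {c} := fun c hc => by
        refine lt_of_le_of_ne le_sup_left fun h => hc ?_
        rw [h]; exact Ideal.mem_sup_right (Ideal.mem_span_singleton_self c)
      let Y := LinearMap.range (LinearMap.lsmul R X a)
      have hY : VE R F Y (j+1) := by
        refine IH _ (hlt b hb) Y ?_
        rintro r hr ⟨_, x, rfl⟩
        obtain ⟨u, hu, w, hw, rfl⟩ := Submodule.mem_sup.1 hr
        obtain ⟨c, rfl⟩ := Ideal.mem_span_singleton'.1 hw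
        apply Subtype.val_injective
        show (u + c * b) • (a • x) = 0
        rw [smul_smul]
        refine hX _ ?_ x
        have : (u + c * b) * a = a * u + c * (a * b) := by ring
        rw [this]
        exact I.add_mem (Ideal.mul_mem_left I _ hu) (Ideal.mul_mem_left I _ hab)
      have hXY : VE R F (X ⧸ Y) (j+1) := by
        refine IH _ (hlt a ha) (X ⧸ Y) ?_
        rintro r hr x
        obtain ⟨u, hu, w, hw, rfl⟩ := Submodule.mem_sup.1 hr
        obtain ⟨c, rfl⟩ := Ideal.mem_span_singleton'.1 hw
        rw [add_smul, mul_smul, quot_smul, smul_zero, add_zero]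
        obtain ⟨x, rfl⟩ := Submodule.mkQ_surjective _ x
        rw [← map_smul, hX u hu, map_zero]
      exact VE.cov2 Y.subtype Y.mkQ Subtype.val_injective (LinearMap.exact_subtype_mkQ Y) (Submodule.mkQ_surjective _) hY hXY

theorem flat_pd {R : Type} [CommRing R] [IsNoetherianRing R] (d : ℕ) (hd : ringKrullDim R = d)
    (F : Type) [AddCommGroup F] [Module R F] [Module.Flat R F] (X : Type) [AddCommGroup X] [Module R X] (i : ℕ)
    (hi : d < i) : VE R F X i :=
  QQ_all (d+1) R (by rw [hd]; simp) F X i hi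


open TensorProduct in
theorem snake_equiv {R : Type} [CommRing R] {A Q X B P Y : Type} [AddCommGroup A] [Module R A] [AddCommGroup Q] [Module R Q]
    [AddCommGroup X] [Module R X] [AddCommGroup B] [Module R B] [AddCommGroup P] [Module R P] [AddCommGroup Y] [Module R Y]
    (i : A →ₗ[R] Q) (q : Q →ₗ[R] X) (hi : Function.Injective i) (hiq : Function.Exact i q) (hq : Function.Surjective q)
    (b : B →ₗ[R] P) (g : P →ₗ[R] Y) (hb : Function.Injective b) (hbg : Function.Exact b g) (hg : Function.Surjective g)
    [Module.Flat R Q] [Module.Flat R P] :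
    Nonempty (LinearMap.ker (b.lTensor X) ≃ₗ[R] LinearMap.ker (i.rTensor Y)) := by
  have comm1 : (i.rTensor P).comp (b.lTensor A) = (b.lTensor Q).comp (i.rTensor B) := by
    rw [LinearMap.rTensor_comp_lTensor, LinearMap.lTensor_comp_rTensor]
  have comm2 : (q.rTensor P).comp (b.lTensor Q) = (b.lTensor X).comp (q.rTensor B) := by
    rw [LinearMap.rTensor_comp_lTensor, LinearMap.lTensor_comp_rTensor]
  have e1 := rTensor_exact B hiq hq
  have e2 := rTensor_exact P hiq hq
  have s1 := LinearMap.rTensor_surjective B hq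
  have i1 : Function.Injective (i.rTensor P) := Module.Flat.rTensor_preserves_injective_linearMap i hi
  have i2 : Function.Injective (b.lTensor Q) := Module.Flat.lTensor_preserves_injective_linearMap b hb
  have e3 : Function.Exact (LinearMap.ker (b.lTensor X)).subtype (b.lTensor X) := LinearMap.exact_subtype_ker_map _
  have e4 := lTensor_exact A hbg hg
  have e5 := lTensor_exact Q hbg hg
  let δ : LinearMap.ker (b.lTensor X) →ₗ[R] A ⊗[R] Y := SnakeLemma.δ' (b.lTensor A) (b.lTensor Q) (b.lTensor X) (i.rTensor B) (q.rTensor B) e1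
    (i.rTensor P) (q.rTensor P) e2 comm1 comm2 (LinearMap.ker (b.lTensor X)).subtype e3 (g.lTensor A) e4 s1 i1
  have hr : Function.Exact (0 : PUnit →ₗ[R] LinearMap.ker (b.lTensor X)) δ :=
    SnakeLemma.exact_δ'_right (b.lTensor A) (b.lTensor Q) (b.lTensor X) (i.rTensor B) (q.rTensor B) e1
    (i.rTensor P) (q.rTensor P) e2 comm1 comm2 (0 : PUnit →ₗ[R] _) (by
      intro y
      constructor
      · intro h; exact ⟨0, by rw [map_zero]; exact (i2 (h.trans (map_zero _).symm)).symm⟩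
      · rintro ⟨_, rfl⟩; simp) (LinearMap.ker (b.lTensor X)).subtype e3 (g.lTensor A) e4 s1 i1 0 (by simp) Subtype.val_injective
  have hl : Function.Exact δ (i.rTensor Y) :=
    SnakeLemma.exact_δ'_left (b.lTensor A) (b.lTensor Q) (b.lTensor X) (i.rTensor B) (q.rTensor B) e1
    (i.rTensor P) (q.rTensor P) e2 comm1 comm2 (LinearMap.ker (b.lTensor X)).subtype e3 (g.lTensor A) e4 (g.lTensor Q) e5 s1 i1 (i.rTensor Y)
    (by rw [LinearMap.rTensor_comp_lTensor, LinearMap.lTensor_comp_rTensor]) (LinearMap.lTensor_surjective A hg)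
  have hinj : Function.Injective δ := by
    rw [injective_iff_map_eq_zero]
    intro a ha
    obtain ⟨_, h⟩ := (hr a).1 ha
    rw [← h]; simp
  have hker : LinearMap.ker (i.rTensor Y) = LinearMap.range δ := hl.linearMap_ker_eq
  exact ⟨(LinearEquiv.ofInjective δ hinj).trans (LinearEquiv.ofEq _ _ hker.symm)⟩

/-- Nakayama property. -/
def Nak {R : Type} [CommRing R] (x : R) (K : Type) [AddCommGroup K] [Module R K] : Prop :=
  (∀ y : K, ∃ y' : K, y = x • y') → ∀ y : K, y = 0

theorem Nak.equiv {R : Type} [CommRing R] {x : R} {K L : Type} [AddCommGroup K] [Module R K] [AddCommGroup L] [Module R L]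
    (e : K ≃ₗ[R] L) (h : Nak x L) : Nak x K := by
  intro hK y
  apply e.injective
  rw [map_zero]
  refine h (fun z => ?_) _
  obtain ⟨y', hy'⟩ := hK (e.symm z)
  exact ⟨e y', by rw [← map_smul, ← hy', e.apply_symm_apply]⟩

theorem fg_pres (R : Type) [CommRing R] [IsNoetherianRing R] (X : Type) [AddCommGroup X] [Module R X] [Module.Finite R X] :
    ∃ (A : Type) (_ : AddCommGroup A) (_ : Module R A) (_ : Module.Finite R A) (n : ℕ) (i : A →ₗ[R] (Fin n → R))
      (q : (Fin n → R) →ₗ[R] X), Function.Injective i ∧ Function.Exact i q ∧ Function.Surjective q := by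
  obtain ⟨n, q, hq⟩ := Module.Finite.exists_fin' R X
  exact ⟨LinearMap.ker q, inferInstance, inferInstance, inferInstance, n, (LinearMap.ker q).subtype, q,
    Subtype.val_injective, LinearMap.exact_subtype_ker_map _, hq⟩

/-- iterated syzygies -/
noncomputable def syz (R : Type) [CommRing R] (N : Type) [AddCommGroup N] [Module R N] : ℕ → ModuleCat.{0} R
  | 0 => ModuleCat.of R N
  | j+1 => ModuleCat.of R (CovK R (syz R N j))

theorem VE_syz {R : Type} [CommRing R] (N : Type) [AddCommGroup N] [Module R N] (B : Type) [AddCommGroup B] [Module R B] (j : ℕ) :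
    ∀ i, VE R N B (j + i + 1) ↔ VE R (syz R N j) B (i+1) := by
  induction j with
  | zero => intro i; rw [zero_add]; exact Iff.rfl
  | succ j ih =>
    intro i
    have := ih (i+1)
    rw [show j + 1 + i + 1 = j + (i + 1) + 1 by omega, this]
    exact ⟨fun h => VE.con1 _ _ (covi_inj R _) (cov_exact R _) (cov_surj R _) (VE.proj i) h,
      fun h => VE.con3 _ _ (covi_inj R _) (cov_exact R _) (cov_surj R _) h (VE.proj _)⟩

open TensorProduct in
theorem nak_base {R S : Type} [CommRing R] [CommRing S] [IsNoetherianRing S] [IsLocalRing S] [Algebra R S]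
    (N : Type) [AddCommGroup N] [Module R N] [Module S N] [IsScalarTower R S N] [Module.Finite S N]
    {A Q : Type} [AddCommGroup A] [Module R A] [Module.Finite R A] [AddCommGroup Q] [Module R Q] (i : A →ₗ[R] Q)
    (x : R) (hx : algebraMap R S x ∈ maximalIdeal S) : Nak x (LinearMap.ker (i.rTensor N)) := by
  have hfin : Module.Finite S (N ⊗[R] A) :=
    Module.Finite.equiv (AlgebraTensorModule.cancelBaseChange R S S N A)
  let φ : N ⊗[R] A →ₗ[S] N ⊗[R] Q := AlgebraTensorModule.map (LinearMap.id : N →ₗ[S] N) i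
  have hφ : ∀ y : A ⊗[R] N, φ (TensorProduct.comm R A N y) = TensorProduct.comm R Q N (i.rTensor N y) := by
    intro y
    induction y with
    | zero => simp
    | add a b ha hb => simp only [map_add, ha, hb]
    | tmul a n => simp [φ]
  intro hK y
  have hb : LinearMap.ker φ = ⊥ := by
    refine Submodule.eq_bot_of_le_smul_of_le_jacobson_bot (Ideal.span {algebraMap R S x}) _ (IsNoetherian.noetherian _) ?_ ?_
    · intro z hz
      obtain ⟨w, rfl⟩ := (TensorProduct.comm R A N).surjective z
      have hw : w ∈ LinearMap.ker (i.rTensor N) := by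
        rw [LinearMap.mem_ker, hφ] at hz
        rw [LinearMap.mem_ker]
        exact (TensorProduct.comm R Q N).map_eq_zero_iff.1 hz
      obtain ⟨w', hw'⟩ := hK ⟨w, hw⟩
      have h1 : w = x • (w' : A ⊗[R] N) := congrArg Subtype.val hw'
      rw [h1, map_smul, ← algebraMap_smul S x]
      refine Submodule.smul_mem_smul (Ideal.mem_span_singleton_self _) ?_
      rw [LinearMap.mem_ker, hφ, LinearMap.mem_ker.1 w'.2, map_zero]
    · rw [IsLocalRing.jacobson_eq_maximalIdeal _ bot_ne_top, Ideal.span_singleton_le_iff_mem]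
      exact hx
  apply Subtype.val_injective
  apply (TensorProduct.comm R A N).injective
  have : TensorProduct.comm R A N y ∈ LinearMap.ker φ := by
    rw [LinearMap.mem_ker, hφ, LinearMap.mem_ker.1 y.2, map_zero]
  rw [hb] at this
  simpa using this

theorem nak_syz {R S : Type} [CommRing R] [IsNoetherianRing R] [CommRing S] [IsNoetherianRing S] [IsLocalRing S] [Algebra R S]
    (N : Type) [AddCommGroup N] [Module R N] [Module S N] [IsScalarTower R S N] [Module.Finite S N]
    (x : R) (hx : algebraMap R S x ∈ maximalIdeal S) (j : ℕ) :
    ∀ (X : Type) [AddCommGroup X] [Module R X] [Module.Finite R X], Nak x (LinearMap.ker ((covi R (syz R N j)).lTensor X)) := by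
  induction j with
  | zero =>
    intro X _ _ _
    obtain ⟨A, _, _, _, n, i, q, hi, hiq, hq⟩ := fg_pres R X
    obtain ⟨e⟩ := snake_equiv i q hi hiq hq _ _ (covi_inj R (syz R N 0)) (cov_exact R _) (cov_surj R _)
    exact Nak.equiv e (nak_base (S := S) N i x hx)
  | succ j ih =>
    intro X _ _ _
    obtain ⟨A, _, _, _, n, i, q, hi, hiq, hq⟩ := fg_pres R X
    obtain ⟨e⟩ := snake_equiv i q hi hiq hq _ _ (covi_inj R (syz R N (j+1))) (cov_exact R _) (cov_surj R _)
    refine Nak.equiv e ?_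
    have : LinearMap.ker (i.rTensor (CovK R (syz R N j))) = LinearMap.ker ((covi R (syz R N j)).lTensor A) := by
      have h1 : ((covi R (syz R N j)).lTensor (Fin n → R)).comp (i.rTensor (CovK R (syz R N j))) =
        (i.rTensor _).comp ((covi R (syz R N j)).lTensor A) := by
        rw [LinearMap.rTensor_comp_lTensor, LinearMap.lTensor_comp_rTensor]
      have h2 := LinearMap.ker_comp_of_ker_eq_bot (i.rTensor (CovK R (syz R N j))) (LinearMap.ker_eq_bot.2
        (Module.Flat.lTensor_preserves_injective_linearMap (M := Fin n → R) (covi R (syz R N j)) (covi_inj R _)))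
      have h3 := LinearMap.ker_comp_of_ker_eq_bot ((covi R (syz R N j)).lTensor A) (LinearMap.ker_eq_bot.2
        (Module.Flat.rTensor_preserves_injective_linearMap (M := (syz R N j) →₀ R) i hi))
      rw [h1] at h2
      exact h2.symm.trans h3
    change Nak x (LinearMap.ker (i.rTensor (CovK R (syz R N j))))
    rw [this]
    exact ih A

theorem half_exact {R : Type} [CommRing R] {X Y Z B P : Type} [AddCommGroup X] [Module R X] [AddCommGroup Y] [Module R Y]
    [AddCommGroup Z] [Module R Z] [AddCommGroup B] [Module R B] [AddCommGroup P] [Module R P] [Module.Flat R P]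
    (u : X →ₗ[R] Y) (v : Y →ₗ[R] Z) (hu : Function.Injective u) (huv : Function.Exact u v) (hv : Function.Surjective v)
    (b : B →ₗ[R] P) (hZ : Function.Injective (b.lTensor Z)) (z) (hz : b.lTensor Y z = 0) :
    ∃ w, b.lTensor X w = 0 ∧ u.rTensor B w = z := by
  have h1 : v.rTensor B z = 0 := by
    apply hZ
    rw [map_zero]
    have : b.lTensor Z (v.rTensor B z) = v.rTensor P (b.lTensor Y z) := by
      simp only [← LinearMap.comp_apply, LinearMap.rTensor_comp_lTensor, LinearMap.lTensor_comp_rTensor]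
    rw [this, hz, map_zero]
  obtain ⟨w, rfl⟩ := (rTensor_exact B huv hv z).1 h1
  refine ⟨w, ?_, rfl⟩
  apply Module.Flat.rTensor_preserves_injective_linearMap (M := P) u hu
  rw [map_zero, ← hz]
  simp only [← LinearMap.comp_apply, LinearMap.rTensor_comp_lTensor, LinearMap.lTensor_comp_rTensor]

open TensorProduct in
theorem inj_residue {R : Type} [CommRing R] [IsLocalRing R] {Y B P : Type} [AddCommGroup Y] [Module R Y]
    [AddCommGroup B] [Module R B] [AddCommGroup P] [Module R P] (b : B →ₗ[R] P) (g : P →ₗ[R] Y)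
    (hb : Function.Injective b) (hbg : Function.Exact b g) (hg : Function.Surjective g)
    (h : VE R Y (ResidueField R) 1) : Function.Injective (b.lTensor (ResidueField R)) := by
  rw [injective_iff_map_eq_zero]
  intro z hz
  rw [← Module.forall_dual_apply_eq_zero_iff (ResidueField R)]
  intro l
  obtain ⟨ψ, hψ⟩ := VE.extend b g hb hbg hg h (l.restrictScalars R ∘ₗ TensorProduct.mk R (ResidueField R) B 1)
  have : l = (LinearMap.liftBaseChange (ResidueField R) ψ) ∘ₗ (b.baseChange (ResidueField R)) := by
    ext x
    have := LinearMap.congr_fun hψ x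
    simpa using this.symm
  rw [this, LinearMap.comp_apply]
  have h2 : b.baseChange (ResidueField R) z = 0 := hz
  rw [h2, map_zero]

theorem inj_all {R : Type} [CommRing R] [IsLocalRing R] [IsNoetherianRing R] {B P : Type} 
    [AddCommGroup B] [Module R B] [AddCommGroup P] [Module R P] [Module.Flat R P] (b : B →ₗ[R] P)
    (hk : Function.Injective (b.lTensor (ResidueField R)))
    (hnak : ∀ x ∈ maximalIdeal R, ∀ I : Ideal R, Nak x (LinearMap.ker (b.lTensor (R ⧸ I)))) (I : Ideal R) :
    Function.Injective (b.lTensor (R ⧸ I)) := by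
  revert I
  suffices H : ∀ I : Submodule R R, Function.Injective (b.lTensor (R ⧸ I)) from H
  intro I
  induction I using IsNoetherian.induction with
  | hgt I IH =>
  by_cases htop : I = ⊤
  · have : Subsingleton (R ⧸ I) := Submodule.Quotient.subsingleton_iff.2 htop
    exact Function.injective_of_subsingleton _
  by_cases hm : I = maximalIdeal R
  · rw [hm]; exact hk
  have hle : I ≤ maximalIdeal R := IsLocalRing.le_maximalIdeal htop
  obtain ⟨x, hx, hxI⟩ := SetLike.exists_of_lt (lt_of_le_of_ne hle hm)
  let L : Submodule R R := I ⊔ Submodule.span R {x}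
  have hL : I < L := lt_of_le_of_ne le_sup_left fun h => hxI (by
    rw [h]; exact Submodule.mem_sup_right (Submodule.mem_span_singleton_self x))
  let v : (R ⧸ I) →ₗ[R] R ⧸ L := Submodule.factor le_sup_left
  have hv : Function.Surjective v := Submodule.factor_surjective _
  have hvker : ∀ r : R, v (Submodule.Quotient.mk r) = 0 ↔ ∃ c : R, Submodule.Quotient.mk (x * c) = (Submodule.Quotient.mk r : R ⧸ I) := by
    intro r
    have : v (Submodule.Quotient.mk r) = Submodule.Quotient.mk r := rfl
    rw [this, Submodule.Quotient.mk_eq_zero, Submodule.mem_sup]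
    constructor
    · rintro ⟨y, hy, z, hz, rfl⟩
      obtain ⟨c, rfl⟩ := Submodule.mem_span_singleton.1 hz
      refine ⟨c, ?_⟩
      rw [Submodule.Quotient.eq]
      have : x * c - (y + c • x) = -y := by rw [smul_eq_mul]; ring
      rw [this]; exact I.neg_mem hy
    · rintro ⟨c, hc⟩
      rw [Submodule.Quotient.eq] at hc
      refine ⟨r - x * c, ?_, c * x, Submodule.mem_span_singleton.2 ⟨c, rfl⟩, by ring⟩
      rw [← neg_sub]; exact I.neg_mem hc
  rw [injective_iff_map_eq_zero]
  intro z hz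
  let J : Submodule R R := I.comap (LinearMap.lsmul R R x)
  have hIJ : I ≤ J := fun r hr => I.smul_mem x hr
  by_cases hJ : J = I
  · let u : (R ⧸ I) →ₗ[R] (R ⧸ I) := LinearMap.lsmul R (R ⧸ I) x
    have hu : Function.Injective u := by
      rw [injective_iff_map_eq_zero]
      intro r hr
      obtain ⟨r, rfl⟩ := Submodule.Quotient.mk_surjective _ r
      have : x • r ∈ I := (Submodule.Quotient.mk_eq_zero I).1 hr
      rw [Submodule.Quotient.mk_eq_zero, ← hJ]; exact this
    have huv : Function.Exact u v := by
      intro r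
      obtain ⟨r, rfl⟩ := Submodule.Quotient.mk_surjective _ r
      rw [hvker]
      constructor
      · rintro ⟨c, hc⟩; exact ⟨Submodule.Quotient.mk c, hc⟩
      · rintro ⟨c, hc⟩
        obtain ⟨c, rfl⟩ := Submodule.Quotient.mk_surjective _ c
        exact ⟨c, hc⟩
    have hall := hnak x hx I (by
      rintro ⟨y, hy⟩
      obtain ⟨w, hw, hwy⟩ := half_exact u v hu huv hv b (IH L hL) y hy
      refine ⟨⟨w, hw⟩, Subtype.val_injective ?_⟩
      show y = x • w
      rw [← hwy]
      have : u = x • LinearMap.id := by ext; rfl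
      rw [this, LinearMap.rTensor_smul]; simp)
    exact congrArg Subtype.val (hall ⟨z, hz⟩)
  · have hlt : I < J := lt_of_le_of_ne hIJ (Ne.symm hJ)
    let u : (R ⧸ J) →ₗ[R] (R ⧸ I) := Submodule.mapQ J I (LinearMap.lsmul R R x) le_rfl
    have hu : Function.Injective u := by
      rw [injective_iff_map_eq_zero]
      intro r hr
      obtain ⟨r, rfl⟩ := Submodule.Quotient.mk_surjective _ r
      have : x • r ∈ I := (Submodule.Quotient.mk_eq_zero I).1 hr
      rw [Submodule.Quotient.mk_eq_zero]; exact this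
    have huv : Function.Exact u v := by
      intro r
      obtain ⟨r, rfl⟩ := Submodule.Quotient.mk_surjective _ r
      rw [hvker]
      constructor
      · rintro ⟨c, hc⟩; exact ⟨Submodule.Quotient.mk c, hc⟩
      · rintro ⟨c, hc⟩
        obtain ⟨c, rfl⟩ := Submodule.Quotient.mk_surjective _ c
        exact ⟨c, hc⟩
    obtain ⟨w, hw, hwz⟩ := half_exact u v hu huv hv b (IH L hL) z hz
    have : w = 0 := IH J hlt (hw.trans (map_zero _).symm)
    rw [← hwz, this, map_zero]

theorem syz_flat {R S : Type} [CommRing R] [IsNoetherianRing R] [IsLocalRing R] [CommRing S] [IsNoetherianRing S] [IsLocalRing S] [Algebra R S]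
    (hloc : ∀ x ∈ maximalIdeal R, algebraMap R S x ∈ maximalIdeal S)
    (N : Type) [AddCommGroup N] [Module R N] [Module S N] [IsScalarTower R S N] [Module.Finite S N] (j : ℕ)
    (h : VE R N (ResidueField R) (j+1)) : Module.Flat R (syz R N j) := by
  have h1 := (VE_syz N (ResidueField R) j 0).1 h
  have h2 := inj_residue _ _ (covi_inj R (syz R N j)) (cov_exact R _) (cov_surj R _) h1
  have h3 := inj_all _ h2 (fun x hx I => nak_syz (S := S) N x (hloc x hx) j (R ⧸ I))
  rw [Module.Flat.iff_rTensor_injective']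
  intro I
  obtain ⟨e⟩ := snake_equiv I.subtype I.mkQ Subtype.val_injective (LinearMap.exact_subtype_mkQ I) (Submodule.mkQ_surjective I)
    _ _ (covi_inj R (syz R N j)) (cov_exact R _) (cov_surj R _)
  have h4 := h3 I
  rw [injective_iff_map_eq_zero]
  intro z hz
  have h5 : e.symm ⟨z, hz⟩ = 0 := by
    apply Subtype.val_injective
    apply h4
    rw [LinearMap.mem_ker.1 (e.symm ⟨z, hz⟩).2]; simp
  have h6 : (⟨z, hz⟩ : LinearMap.ker (I.subtype.rTensor (syz R N j))) = 0 := by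
    rw [← e.apply_symm_apply ⟨z, hz⟩, h5, map_zero]
  exact congrArg Subtype.val h6


theorem flat_char {R : Type} [CommRing R] (X : Type) [AddCommGroup X] [Module R X] (i : ℕ) :
    ∀ (F : Type) [AddCommGroup F] [Module R F] [Module.Flat R F], VE R F (CharacterModule X) (i+1) := by
  induction i with
  | zero =>
    intro F _ _ _
    refine VE.of_extend _ _ (covi_inj R F) (cov_exact R F) (cov_surj R F) fun φ => ?_
    have h := flat_ker_inj _ _ (covi_inj R F) (cov_exact R F) (cov_surj R F) X
    have h' : Function.Injective ((covi R F).rTensor X) := LinearMap.lTensor_inj_iff_rTensor_inj X _ |>.1 h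
    exact rTensor_injective_iff_lcomp_surjective.1 h' φ
  | succ i ih =>
    intro F _ _ _
    have := cov_flat R F
    exact VE.con3 _ _ (covi_inj R _) (cov_exact R _) (cov_surj R _) (ih (CovK R F)) (VE.proj _)

open TensorProduct in
theorem tor_of_ext {R : Type} [CommRing R] (N : ModuleCat.{0} R) (X : ModuleCat.{0} R) (n : ℕ)
    (h : VE R N (CharacterModule X) (n+1)) : Subsingleton (((Tor (ModuleCat R) (n+1)).obj X).obj N) := by
  let P := projectiveResolution N
  have h1 := (newExt_succ_iff R n N (ModuleCat.of R (CharacterModule X)) P).1 h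
  rw [← ModuleCat.isZero_iff_subsingleton]
  change Limits.IsZero ((Functor.leftDerived ((MonoidalCategory.tensoringLeft (ModuleCat R)).obj X) (n+1)).obj N)
  rw [(P.isoLeftDerivedObj ((MonoidalCategory.tensoringLeft (ModuleCat R)).obj X) (n+1)).isZero_iff]
  change Limits.IsZero (HomologicalComplex.homology _ (n+1))
  rw [← HomologicalComplex.exactAt_iff_isZero_homology,
    HomologicalComplex.exactAt_iff' _ (n+2) (n+1) n (by simp) (by simp), ShortComplex.moduleCat_exact_iff]
  let a : X ⊗[R] P.complex.X (n+2) →ₗ[R] X ⊗[R] P.complex.X (n+1) := (P.complex.d (n+2) (n+1)).hom.lTensor X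
  let b : X ⊗[R] P.complex.X (n+1) →ₗ[R] X ⊗[R] P.complex.X n := (P.complex.d (n+1) n).hom.lTensor X
  change ∀ z : X ⊗[R] P.complex.X (n+1), b z = 0 → ∃ y, a y = z
  intro z hz
  change z ∈ LinearMap.range a
  rw [← Submodule.Quotient.mk_eq_zero]
  apply CharacterModule.eq_zero_of_character_apply
  intro c
  let c' : CharacterModule (X ⊗[R] P.complex.X (n+1)) := CharacterModule.dual (LinearMap.range a).mkQ c
  change c' z = 0
  let f : P.complex.X (n+1) →ₗ[R] CharacterModule X := CharacterModule.curry (CharacterModule.dual (TensorProduct.comm R _ _).toLinearMap c')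
  have hf : ∀ w x, f w x = c' (x ⊗ₜ w) := fun w x => rfl
  obtain ⟨g, hg⟩ := h1 (ModuleCat.ofHom f) (by
    ext w x
    change c ((LinearMap.range a).mkQ (x ⊗ₜ (P.complex.d (n+2) (n+1)).hom w)) = 0
    have : (LinearMap.range a).mkQ (x ⊗ₜ (P.complex.d (n+2) (n+1)).hom w) = 0 := by
      rw [Submodule.mkQ_apply, Submodule.Quotient.mk_eq_zero]
      exact ⟨x ⊗ₜ w, rfl⟩
    rw [this, map_zero])
  have hg' : ∀ w, g.hom ((P.complex.d (n+1) n).hom w) = f w := fun w => congrArg (fun u => u.hom w) hg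
  let c'' : CharacterModule (X ⊗[R] P.complex.X n) := CharacterModule.dual (TensorProduct.comm R _ _).toLinearMap (CharacterModule.uncurry g.hom)
  have hc : ∀ y, c' y = c'' (b y) := by
    intro y
    induction y with
    | zero => rw [map_zero, map_zero, map_zero]
    | add u v hu hv => rw [map_add, map_add, map_add, hu, hv]
    | tmul x w =>
      rw [← hf, ← hg']
      rfl
  rw [hc, hz, map_zero]

section frob
variable {R : Type} [CommRing R] (p : ℕ) [ExpChar R p] (e : ℕ)

theorem frob_smul {X : Type} [AddCommGroup X] [Module R X] (r : R) (x : X) :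
    (r • (show FrobTwist R p e X from x) : FrobTwist R p e X) = (show FrobTwist R p e X from (r ^ p ^ e) • x) := rfl

/-- functoriality of the twist -/
def frobMap {X Y : Type} [AddCommGroup X] [Module R X] [AddCommGroup Y] [Module R Y] (g : X →ₗ[R] Y) :
    FrobTwist R p e X →ₗ[R] FrobTwist R p e Y where
  toFun := fun x => g x
  map_add' := fun a b => g.map_add a b
  map_smul' := fun r x => g.map_smul (r ^ p ^ e) x

theorem frobMap_surj {X Y : Type} [AddCommGroup X] [Module R X] [AddCommGroup Y] [Module R Y] (g : X →ₗ[R] Y)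
    (h : Function.Surjective g) : Function.Surjective (frobMap p e g) := h

theorem frobMap_inj {X Y : Type} [AddCommGroup X] [Module R X] [AddCommGroup Y] [Module R Y] (g : X →ₗ[R] Y)
    (h : Function.Injective g) : Function.Injective (frobMap p e g) := h

theorem frobMap_exact {X Y Z : Type} [AddCommGroup X] [Module R X] [AddCommGroup Y] [Module R Y] [AddCommGroup Z] [Module R Z]
    (f : X →ₗ[R] Y) (g : Y →ₗ[R] Z)
    (h : Function.Exact f g) : Function.Exact (frobMap p e f) (frobMap p e g) := h

open Pointwise in
theorem frob_chain {N : Type} [AddCommGroup N] [Module R N] (t : ℕ) (rs : List R) :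
    ∀ (M : Type) [AddCommGroup M] [Module R M], RingTheory.Sequence.IsWeaklyRegular M rs →
      (∀ i, t ≤ i → i ≤ t + rs.length → VE R N (FrobTwist R p e M) i) →
      VE R N (FrobTwist R p e (M ⧸ (Ideal.ofList rs • ⊤ : Submodule R M))) t := by
  induction rs with
  | nil =>
    intro M _ _ _ h
    have hb : (Ideal.ofList ([] : List R) • ⊤ : Submodule R M) = ⊥ := by simp
    let E := Submodule.quotEquivOfEqBot _ hb
    refine VE.retract (frobMap p e E.toLinearMap) (frobMap p e E.symm.toLinearMap) ?_ (h t le_rfl (by simp))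
    ext x; exact E.symm_apply_apply x
  | cons r rs ih =>
    intro M _ _ hreg h
    obtain ⟨h1, h2⟩ := (RingTheory.Sequence.isWeaklyRegular_cons_iff M r rs).1 hreg
    have hex : Function.Exact (LinearMap.lsmul R M r) (r • ⊤ : Submodule R M).mkQ := by
      intro x
      rw [Submodule.mkQ_apply, Submodule.Quotient.mk_eq_zero]
      constructor
      · rintro ⟨y, _, hy⟩; exact ⟨y, hy⟩
      · rintro ⟨y, hy⟩; exact ⟨y, trivial, hy⟩
    have h3 := ih (QuotSMulTop r M) h2 (fun i hi hi' => by
      have ha := h i hi (by simp; omega)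
      have hb := h (i+1) (by omega) (by simp; omega)
      refine VE.cov3 (frobMap p e (LinearMap.lsmul R M r)) (frobMap p e (r • ⊤ : Submodule R M).mkQ) (frobMap_inj p e _ h1)
        (frobMap_exact p e _ _ hex) (frobMap_surj p e _ (Submodule.mkQ_surjective _)) ha hb)
    let E := Submodule.quotOfListConsSMulTopEquivQuotSMulTopInner M r rs
    refine VE.retract (frobMap p e E.toLinearMap) (frobMap p e E.symm.toLinearMap) ?_ h3
    ext x; exact E.symm_apply_apply x

theorem residue_retract [IsLocalRing R] {Y : Type} [AddCommGroup Y] [Module R Y] (z : Y)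
    (hz : ∀ r ∈ maximalIdeal R, r • z = 0) (hz' : z ∉ (maximalIdeal R • ⊤ : Submodule R Y)) :
    ∃ (i : ResidueField R →ₗ[R] Y) (q : Y →ₗ[R] ResidueField R), q ∘ₗ i = LinearMap.id := by
  let i : (R ⧸ maximalIdeal R) →ₗ[R] Y := Submodule.liftQ (maximalIdeal R) (LinearMap.toSpanSingleton R Y z) (fun r hr => hz r hr)
  letI : Module (ResidueField R) (Y ⧸ (maximalIdeal R • ⊤ : Submodule R Y)) :=
    inferInstanceAs (Module (R ⧸ maximalIdeal R) (Y ⧸ (maximalIdeal R • ⊤ : Submodule R Y)))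
  haveI : IsScalarTower R (ResidueField R) (Y ⧸ (maximalIdeal R • ⊤ : Submodule R Y)) :=
    inferInstanceAs (IsScalarTower R (R ⧸ maximalIdeal R) (Y ⧸ (maximalIdeal R • ⊤ : Submodule R Y)))
  let zb : Y ⧸ (maximalIdeal R • ⊤ : Submodule R Y) := Submodule.Quotient.mk z
  have hzb : zb ≠ 0 := fun h => hz' ((Submodule.Quotient.mk_eq_zero _).1 h)
  have hl : ∃ l : Module.Dual (ResidueField R) (Y ⧸ (maximalIdeal R • ⊤ : Submodule R Y)), l zb ≠ 0 := by
    by_contra! h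
    exact hzb ((Module.forall_dual_apply_eq_zero_iff (ResidueField R) zb).1 h)
  obtain ⟨l, hl⟩ := hl
  let l' := (l zb)⁻¹ • l
  have hl' : l' zb = 1 := inv_mul_cancel₀ hl
  refine ⟨i, (l'.restrictScalars R) ∘ₗ (maximalIdeal R • ⊤ : Submodule R Y).mkQ, ?_⟩
  ext x
  obtain ⟨r, rfl⟩ := Submodule.Quotient.mk_surjective (maximalIdeal R) x
  change (l'.restrictScalars R) (Submodule.Quotient.mk (r • z)) = _
  rw [Submodule.Quotient.mk_smul, map_smul]
  change r • l' zb = _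
  rw [hl', Algebra.smul_def, mul_one]
  rfl

theorem frob_residue [IsLocalRing R] {X : Type} [AddCommGroup X] [Module R X] (e' : ℕ) (he : e' ≤ e) (z : X)
    (hz : ∀ r ∈ maximalIdeal R, (r ^ p ^ e') • z = 0)
    (hz' : z ∉ (Ideal.span ((fun r : R => r ^ p ^ e') '' (maximalIdeal R : Set R))) • (⊤ : Submodule R X)) 
    {N : Type} [AddCommGroup N] [Module R N] {t : ℕ} (h : VE R N (FrobTwist R p e X) t) : VE R N (ResidueField R) t := by
  obtain ⟨c, rfl⟩ := Nat.exists_eq_add_of_le he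
  have hp0 : p ^ c ≠ 0 := pow_ne_zero _ (expChar_pos R p).ne'
  have hmem : ∀ r ∈ maximalIdeal R, r ^ p ^ c ∈ maximalIdeal R := fun r hr => Ideal.pow_mem_of_mem _ hr _ (Nat.pos_of_ne_zero hp0)
  have hpow : ∀ r : R, r ^ p ^ (e' + c) = (r ^ p ^ c) ^ p ^ e' := fun r => by rw [← pow_mul, pow_add, mul_comm]
  obtain ⟨i, q, hiq⟩ := residue_retract (R := R) (Y := FrobTwist R p (e'+c) X) z (by
    intro r hr
    have h0 := hz _ (hmem r hr)
    rw [← hpow] at h0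
    exact h0) (by
    intro hmz
    refine hz' ?_
    let T : AddSubgroup X := ((Ideal.span ((fun r : R => r ^ p ^ e') '' (maximalIdeal R : Set R))) • (⊤ : Submodule R X)).toAddSubgroup
    let F : FrobTwist R p (e'+c) X → Prop := fun y => @Membership.mem X (AddSubgroup X) _ T y
    suffices H : ∀ y ∈ (maximalIdeal R • ⊤ : Submodule R (FrobTwist R p (e'+c) X)), F y from H z hmz
    intro y hy
    refine Submodule.smul_induction_on (p := F) hy ?_ ?_
    · intro r hr y _
      have h0 : ∀ y : X, (r ^ p ^ (e' + c)) • y ∈ T := by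
        intro y
        rw [hpow]
        exact Submodule.smul_mem_smul (Ideal.subset_span ⟨_, hmem r hr, rfl⟩) trivial
      exact h0 y
    · intro x y hx hy
      exact T.add_mem hx hy)
  exact VE.retract i q hiq h
end frob

theorem depth_len {R : Type} [CommRing R] [IsNoetherianRing R] [IsLocalRing R]
    (M : Type) [AddCommGroup M] [Module R M] [Module.Finite R M] [Nontrivial M]
    (v : ℕ) (hv : ¬ Subsingleton (extGroup R v (ResidueField R) M)) (rs : List R) (hrs : ∀ r ∈ rs, r ∈ maximalIdeal R)
    (hreg : RingTheory.Sequence.IsWeaklyRegular M rs) : rs.length ≤ v := by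
  by_contra! hlt
  apply hv
  apply oldExt_of_new
  haveI : Module.Finite R (ResidueField R) := inferInstanceAs (Module.Finite R (R ⧸ maximalIdeal R))
  refine ModuleCat.subsingleton_ext_of_exists_isRegular (maximalIdeal R) (ModuleCat.of R (ResidueField R)) ?_
    (ModuleCat.of R M) ?_ rs hrs ((IsLocalRing.isRegular_iff_isWeaklyRegular_of_subset_maximalIdeal hrs).2 hreg) v hlt
  · change Module.support R (R ⧸ maximalIdeal R) ⊆ _
    rw [Module.support_eq_zeroLocus, Ideal.annihilator_quotient]
  · rw [lt_top_iff_ne_top]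
    exact (Submodule.top_ne_ideal_smul_of_le_jacobson_annihilator (M := M) (IsLocalRing.maximalIdeal_le_jacobson _)).symm

/-- Koh–Lee type result: if `e ≥ crs_p(M)` and `Ext_R^i(N, ᵉM) = 0` for `i = t, …, t+v`
(`v = depth M`), then `fd_R N ≤ t−1` and hence `pd_R N ≤ t−1+dim R`. -/
theorem stmt_14 (R : Type) [CommRing R] [IsNoetherianRing R] [IsLocalRing R]
    (S : Type) [CommRing S] [IsNoetherianRing S] [IsLocalRing S]
    (p : ℕ) [Fact p.Prime] [CharP R p] [CharP S p]
    (f : R →+* S) [IsLocalHom f]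
    (M : Type) [AddCommGroup M] [Module R M] [Module.Finite R M] [Nontrivial M]
    (v : ℕ)
    (hdepth : (∀ i < v, Subsingleton (extGroup R i (ResidueField R) M)) ∧
      ¬ Subsingleton (extGroup R v (ResidueField R) M))
    (N : Type) [AddCommGroup N] [Module S N] [Module.Finite S N]
    (t : ℕ) (ht : 1 ≤ t) (e : ℕ)
    -- `e ≥ crs_p(M)`:
    (hcrs : ∃ e' ≤ e, ∃ rs : List R, (∀ r ∈ rs, r ∈ maximalIdeal R) ∧
      RingTheory.Sequence.IsWeaklyRegular M rs ∧
      ∃ z : M ⧸ (Ideal.ofList rs • ⊤ : Submodule R M),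
        (∀ r ∈ maximalIdeal R, (r ^ p ^ e') • z = 0) ∧
        z ∉ (Ideal.span ((fun r => r ^ p ^ e') '' (maximalIdeal R : Set R))) •
          (⊤ : Submodule R (M ⧸ (Ideal.ofList rs • ⊤ : Submodule R M))))
    (hvanish : ∀ i, t ≤ i → i ≤ t + v →
      Subsingleton (extGroup R i (Restrict f N) (FrobTwist R p e M)))
    (d : ℕ) (hd : ringKrullDim R = d) :
    flatDimLE R (Restrict f N) (t - 1) ∧ projDimLE R (Restrict f N) (t - 1 + d) := by
  obtain ⟨e', he', rs, hrs, hreg, z, hz, hz'⟩ := hcrs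
  have hlen := depth_len M v hdepth.2 rs hrs hreg
  have hk : VE R (Restrict f N) (ResidueField R) t := by
    refine frob_residue p e e' he' z hz hz' (frob_chain p e t rs M hreg fun i hi hi' => ?_)
    obtain ⟨j, rfl⟩ : ∃ j, i = j + 1 := ⟨i - 1, by omega⟩
    exact newExt_of_old R j _ _ (hvanish (j+1) hi (by omega))
  obtain ⟨s, rfl⟩ : ∃ s, t = s + 1 := ⟨t - 1, by omega⟩
  rw [Nat.add_sub_cancel]
  letI : Algebra R S := f.toAlgebra
  letI : Module S (Restrict f N) := inferInstanceAs (Module S N)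
  haveI : Module.Finite S (Restrict f N) := inferInstanceAs (Module.Finite S N)
  haveI : IsScalarTower R S (Restrict f N) := ⟨fun a b c => by
    change (f a * b) • (show N from c) = (f a) • b • (show N from c)
    rw [mul_smul]⟩
  have hflat : Module.Flat R (syz R (Restrict f N) s) :=
    syz_flat (S := S) (fun x hx => by
      rw [mem_maximalIdeal, mem_nonunits_iff] at hx ⊢
      exact fun h => hx (isUnit_of_map_unit f x h)) (Restrict f N) s hk
  constructor
  · intro X i hi
    obtain ⟨j, rfl⟩ := Nat.exists_eq_add_of_lt hi
    refine tor_of_ext (ModuleCat.of R (Restrict f N)) X (s + j) ?_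
    exact (VE_syz (Restrict f N) (CharacterModule X) s j).2 (flat_char X j _)
  · intro X i hi
    obtain ⟨j, rfl⟩ := Nat.exists_eq_add_of_lt hi
    apply oldExt_of_new
    rw [add_assoc s d j]
    exact (VE_syz (Restrict f N) X s (d + j)).2 (flat_pd d hd _ X _ (by omega))
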